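/- For n ≥ 9, the perfect matching M = {u_i v_i : 0 ≤ i ≤ n−1} of P(n,2) consisting of all n spokes has forcing number f(P(n,2),M) = ⌈n/4⌉; moreover S = {u_{4i} v_{4i} : 0 ≤ i ≤ ⌈n/4⌉ − 1} is a minimum forcing set of M. -/

import Mathlib

open SimpleGraph

/-- Vertices of the generalized Petersen graph `P(n,2)`:
`Sum.inl i` is the outer vertex `u_i`, `Sum.inr i` is the inner vertex `v_i`. -/
abbrev PV (n : ℕ) := ZMod n ⊕ ZMod n

/-- The outer vertex `u_i`. -/
def pu {n : ℕ} (i : ZMod n) : PV n := Sum.inl i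

/-- The inner vertex `v_i`. -/
def pv {n : ℕ} (i : ZMod n) : PV n := Sum.inr i

/-- The generalized Petersen graph `P(n,2)`, with edges
`u_i u_{i+2}`, `u_i v_i` (spokes) and `v_i v_{i+1}`, indices mod `n`. -/
def petersen (n : ℕ) : SimpleGraph (PV n) :=
  SimpleGraph.fromRel (fun x y =>
    (∃ i : ZMod n, x = pu i ∧ y = pu (i + 2)) ∨
    (∃ i : ZMod n, x = pu i ∧ y = pv i) ∨
    (∃ i : ZMod n, x = pv i ∧ y = pv (i + 1)))

/-- `S` is a forcing set of the perfect matching `M` of `G`: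
`S ⊆ M` and `S` is contained in no other perfect matching of `G`. -/
def IsForcingSet {V : Type*} (G : SimpleGraph V) (M : G.Subgraph) (S : Set (Sym2 V)) : Prop :=
  S ⊆ M.edgeSet ∧
    ∀ M' : G.Subgraph, M'.IsPerfectMatching → S ⊆ M'.edgeSet → M' = M

/-- The forcing number `f(G,M)`: the minimum cardinality of a forcing set of `M`. -/
noncomputable def forcingNumber {V : Type*} (G : SimpleGraph V) (M : G.Subgraph) : ℕ :=
  sInf {k | ∃ S : Set (Sym2 V), IsForcingSet G M S ∧ S.ncard = k}

/-- Block `A` starting at position `i` (length 4). -/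
def blockA (n : ℕ) (i : ZMod n) : Set (Sym2 (PV n)) :=
  {s(pu i, pu (i + 2)), s(pu (i + 1), pu (i + 3)), s(pv i, pv (i + 1)), s(pv (i + 2), pv (i + 3))}

/-- Block `B` at position `i` (length 1): a single spoke. -/
def blockB (n : ℕ) (i : ZMod n) : Set (Sym2 (PV n)) :=
  {s(pu i, pv i)}

/-- Block `C` starting at position `i` (length 3). -/
def blockC (n : ℕ) (i : ZMod n) : Set (Sym2 (PV n)) :=
  {s(pu i, pu (i + 2)), s(pu (i + 1), pv (i + 1)), s(pv (i + 2), pv (i + 3))}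

/-- Block `D` starting at position `i` (length 4). -/
def blockD (n : ℕ) (i : ZMod n) : Set (Sym2 (PV n)) :=
  {s(pu i, pu (i + 2)), s(pu (i + 1), pu (i + 3)), s(pv (i + 1), pv (i + 2)), s(pv (i + 3), pv (i + 4))}

/-- Length of an `A`/`B` block: `true` codes `A` (length 4), `false` codes `B` (length 1). -/
def abLen (b : Bool) : ℕ := if b then 4 else 1

/-- Edge set of a concatenation of `A`/`B` blocks starting at position `i`. -/
def abEdges (n : ℕ) : ZMod n → List Bool → Set (Sym2 (PV n))
  | _, [] => ∅
  | i, true :: L => blockA n i ∪ abEdges n (i + 4) L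
  | i, false :: L => blockB n i ∪ abEdges n (i + 1) L

/-- A perfect matching (given as a subgraph of `P(n,2)`) has type 1 if its edge set is
a cyclic concatenation of `A` and `B` blocks whose lengths sum to `n`. -/
def IsType1 {n : ℕ} (M : (petersen n).Subgraph) : Prop :=
  ∃ (i : ZMod n) (L : List Bool), (L.map abLen).sum = n ∧ M.edgeSet = abEdges n i L

/-- Length of a `C`/`D` block: `true` codes `C` (length 3), `false` codes `D` (length 4). -/
def cdLen (b : Bool) : ℕ := if b then 3 else 4

/-- Edge set of a concatenation of `C`/`D` blocks starting at position `i`. -/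
def cdEdges (n : ℕ) : ZMod n → List Bool → Set (Sym2 (PV n))
  | _, [] => ∅
  | i, true :: L => blockC n i ∪ cdEdges n (i + 3) L
  | i, false :: L => blockD n i ∪ cdEdges n (i + 4) L

/-- A perfect matching (given as a subgraph of `P(n,2)`) has type 2 if its edge set is
a cyclic concatenation of `C` and `D` blocks whose lengths sum to `n`. -/
def IsType2 {n : ℕ} (M : (petersen n).Subgraph) : Prop :=
  ∃ (i : ZMod n) (L : List Bool), (L.map cdLen).sum = n ∧ M.edgeSet = cdEdges n i L

lemma petersen_adj_pu {n : ℕ} {i : ZMod n} {y : PV n} (h : (petersen n).Adj (pu i) y) :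
    y = pu (i + 2) ∨ y = pu (i - 2) ∨ y = pv i := by
  rw [petersen, SimpleGraph.fromRel_adj] at h
  simp only [pu, pv] at *
  grind

lemma petersen_adj_pv {n : ℕ} {i : ZMod n} {y : PV n} (h : (petersen n).Adj (pv i) y) :
    y = pv (i + 1) ∨ y = pv (i - 1) ∨ y = pu i := by
  rw [petersen, SimpleGraph.fromRel_adj] at h
  simp only [pu, pv] at *
  grind

lemma petersen_adj_spoke {n : ℕ} (i : ZMod n) : (petersen n).Adj (pu i) (pv i) := by
  rw [petersen, SimpleGraph.fromRel_adj]
  exact ⟨Sum.inl_ne_inr, Or.inl (Or.inr (Or.inl ⟨i, rfl, rfl⟩))⟩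

lemma petersen_adj_outer {n : ℕ} (h2 : (2 : ZMod n) ≠ 0) (i : ZMod n) :
    (petersen n).Adj (pu i) (pu (i + 2)) := by
  rw [petersen, SimpleGraph.fromRel_adj]
  refine ⟨fun h => h2 ?_, Or.inl (Or.inl ⟨i, rfl, rfl⟩)⟩
  simpa [pu] using h

lemma petersen_adj_inner {n : ℕ} (h1 : (1 : ZMod n) ≠ 0) (i : ZMod n) :
    (petersen n).Adj (pv i) (pv (i + 1)) := by
  rw [petersen, SimpleGraph.fromRel_adj]
  refine ⟨fun h => h1 ?_, Or.inl (Or.inr (Or.inr ⟨i, rfl, rfl⟩))⟩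
  simpa [pv] using h

lemma spoke_injective (n : ℕ) :
    Function.Injective fun i : ZMod n => (s(pu i, pv i) : Sym2 (PV n)) := by
  intro i j h
  simpa [pu, pv] using h

lemma natCast_zmod_ne_zero {n k : ℕ} (hk : 0 < k) (hkn : k < n) : (k : ZMod n) ≠ 0 := by
  rw [Ne, ZMod.natCast_eq_zero_iff]
  exact Nat.not_dvd_of_pos_of_lt hk hkn

lemma isPerfectMatching_of_edgeSet_eq_spokes {n : ℕ} {M : (petersen n).Subgraph}
    (hE : M.edgeSet = {e | ∃ i : ZMod n, e = s(pu i, pv i)}) : M.IsPerfectMatching := by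
  have hadj (x y : PV n) : M.Adj x y ↔ ∃ i : ZMod n, s(x, y) = s(pu i, pv i) := by
    rw [← SimpleGraph.Subgraph.mem_edgeSet, hE]
    rfl
  rw [SimpleGraph.Subgraph.isPerfectMatching_iff]
  rintro (i | i)
  · refine ⟨pv i, (hadj _ _).2 ⟨i, rfl⟩, fun y hy => ?_⟩
    obtain ⟨j, hj⟩ := (hadj _ _).1 hy
    simp only [pu, pv, Sym2.eq_iff] at *
    grind
  · refine ⟨pu i, (hadj _ _).2 ⟨i, Sym2.eq_swap⟩, fun y hy => ?_⟩
    obtain ⟨j, hj⟩ := (hadj _ _).1 hy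
    simp only [pu, pv, Sym2.eq_iff] at *
    grind

/-- A perfect matching contained in another one is equal to it. -/
lemma SimpleGraph.Subgraph.IsPerfectMatching.eq_of_edgeSet_subset {V : Type*} {G : SimpleGraph V}
    {M M' : G.Subgraph} (hM : M.IsPerfectMatching) (hM' : M'.IsPerfectMatching)
    (h : M.edgeSet ⊆ M'.edgeSet) : M' = M := by
  have hle {x y : V} (hxy : M.Adj x y) : M'.Adj x y := @h s(x, y) hxy
  refine SimpleGraph.Subgraph.ext ?_ ?_
  · rw [hM.2.verts_eq_univ, hM'.2.verts_eq_univ]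
  · funext x y
    refine propext ⟨fun hxy => ?_, hle⟩
    obtain ⟨z, hz, -⟩ := hM.1 (hM.2 x)
    exact hM'.1.eq_of_adj_left hxy (hle hz) ▸ hz

/-- If `u_{i-2}` and `u_{i+2}` are matched by spokes then so is `u_i`. -/
lemma spoke_of_outer_neighbors {n : ℕ} {M' : (petersen n).Subgraph} (hM' : M'.IsPerfectMatching)
    {i : ZMod n} (h₁ : M'.Adj (pu (i - 2)) (pv (i - 2))) (h₂ : M'.Adj (pu (i + 2)) (pv (i + 2))) :
    M'.Adj (pu i) (pv i) := by
  obtain ⟨y, hy, -⟩ := hM'.1 (hM'.2 (pu i))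
  rcases petersen_adj_pu hy.adj_sub with rfl | rfl | rfl
  · exact absurd (hM'.1.eq_of_adj_left h₂ hy.symm) Sum.inr_ne_inl
  · exact absurd (hM'.1.eq_of_adj_left h₁ hy.symm) Sum.inr_ne_inl
  · exact hy

/-- If `v_{i-1}` and `v_{i+1}` are matched by spokes then so is `v_i`. -/
lemma spoke_of_inner_neighbors {n : ℕ} {M' : (petersen n).Subgraph} (hM' : M'.IsPerfectMatching)
    {i : ZMod n} (h₁ : M'.Adj (pu (i - 1)) (pv (i - 1))) (h₂ : M'.Adj (pu (i + 1)) (pv (i + 1))) :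
    M'.Adj (pu i) (pv i) := by
  obtain ⟨y, hy, -⟩ := hM'.1 (hM'.2 (pv i))
  rcases petersen_adj_pv hy.adj_sub with rfl | rfl | rfl
  · exact absurd (hM'.1.eq_of_adj_left h₂.symm hy.symm) Sum.inl_ne_inr
  · exact absurd (hM'.1.eq_of_adj_left h₁.symm hy.symm) Sum.inl_ne_inr
  · exact hy.symm

/-- A perfect matching containing the spokes at all multiples of `4` below `n` contains
every spoke. -/
lemma spoke_of_multiples_of_four {n : ℕ} (hn : 5 ≤ n) {M' : (petersen n).Subgraph}
    (hM' : M'.IsPerfectMatching)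
    (hS : ∀ k : ℕ, 4 * k < n → M'.Adj (pu ((4 * k : ℕ) : ZMod n)) (pv ((4 * k : ℕ) : ZMod n)))
    (i : ZMod n) : M'.Adj (pu i) (pv i) := by
  have : NeZero n := ⟨by omega⟩
  let Q : ℕ → Prop := fun m => M'.Adj (pu (m : ZMod n)) (pv (m : ZMod n))
  have outer (m : ℕ) (h₁ : Q m) (h₂ : Q (m + 4)) : Q (m + 2) := by
    refine spoke_of_outer_neighbors hM' ?_ ?_
    · convert h₁ using 2 <;> push_cast <;> ring
    · convert h₂ using 2 <;> push_cast <;> ring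
  have inner (m : ℕ) (h₁ : Q m) (h₂ : Q (m + 2)) : Q (m + 1) := by
    refine spoke_of_inner_neighbors hM' ?_ ?_
    · convert h₁ using 2 <;> push_cast <;> ring
    · convert h₂ using 2 <;> push_cast <;> ring
  have wrap (m : ℕ) (h : Q m) : Q (n + m) := by simpa [Q] using h
  have hQ0 : Q 0 := hS 0 (by omega)
  have full (a : ℕ) (h₁ : Q (4 * a)) (h₂ : Q (4 * a + 4)) (r : ℕ) (hr : r < 4) :
      Q (4 * a + r) := by
    have hmid := outer _ h₁ h₂
    interval_cases r
    · exact h₁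
    · exact inner _ h₁ hmid
    · exact hmid
    · exact inner _ hmid h₂
  have hQ1 : Q 1 := full 0 hQ0 (hS 1 (by omega)) 1 (by omega)
  have key (m : ℕ) (hm : m < n) : Q m := by
    have hdm := Nat.div_add_mod m 4
    have hlt := Nat.mod_lt m (y := 4) (by omega)
    generalize m / 4 = a at hdm
    generalize m % 4 = r at hdm hlt
    subst hdm
    have h₁ : Q (4 * a) := hS a (by omega)
    rcases lt_trichotomy (4 * a + 4) n with h | h | h
    · exact full a h₁ (hS (a + 1) (by omega)) r hlt
    · exact full a h₁ (by rw [h]; exact wrap 0 hQ0) r hlt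
    · obtain h | h | h : n = 4 * a + 1 ∨ n = 4 * a + 2 ∨ n = 4 * a + 3 := by omega
      · obtain rfl : r = 0 := by omega
        exact h₁
      · have h₂ : Q (4 * a + 2) := by
          have := wrap 0 hQ0
          rwa [show n + 0 = 4 * a + 2 by omega] at this
        obtain rfl | rfl : r = 0 ∨ r = 1 := by omega
        · exact h₁
        · exact inner _ h₁ h₂
      · have h₂ : Q (4 * a + 4) := by
          have := wrap 1 hQ1
          rwa [show n + 1 = 4 * a + 4 by omega] at this
        exact full a h₁ h₂ r hlt
  simpa [Q] using key i.val i.val_lt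

/-- The involution matching the vertices of `P(n,2)` by a block `A` at position `i` and by spokes
elsewhere. -/
def blockAPartner {n : ℕ} (i : ZMod n) : PV n → PV n
  | Sum.inl j =>
    if j = i then pu (i + 2) else if j = i + 2 then pu i else
    if j = i + 1 then pu (i + 3) else if j = i + 3 then pu (i + 1) else pv j
  | Sum.inr j =>
    if j = i then pv (i + 1) else if j = i + 1 then pv i else
    if j = i + 2 then pv (i + 3) else if j = i + 3 then pv (i + 2) else pu j

lemma blockAPartner_blockAPartner {n : ℕ} (h1 : (1 : ZMod n) ≠ 0) (h2 : (2 : ZMod n) ≠ 0)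
    (h3 : (3 : ZMod n) ≠ 0) (i : ZMod n) (x : PV n) :
    blockAPartner i (blockAPartner i x) = x := by
  have e1 : i + 1 ≠ i := by simpa using h1
  have e2 : i + 2 ≠ i := by simpa using h2
  have e3 : i + 3 ≠ i := by simpa using h3
  have e21 : i + 2 ≠ i + 1 := fun h => h1 (by linear_combination h)
  have e31 : i + 3 ≠ i + 1 := fun h => h2 (by linear_combination h)
  have e32 : i + 3 ≠ i + 2 := fun h => h1 (by linear_combination h)
  rcases x with j | j <;> simp only [blockAPartner, pu, pv] <;> grind

lemma petersen_adj_blockAPartner {n : ℕ} (h1 : (1 : ZMod n) ≠ 0) (h2 : (2 : ZMod n) ≠ 0)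
    (i : ZMod n) (x : PV n) : (petersen n).Adj x (blockAPartner i x) := by
  have e : i + 3 = i + 1 + 2 := by ring
  have e' : i + 3 = i + 2 + 1 := by ring
  rcases x with j | j <;> simp only [blockAPartner] <;> split_ifs with a b c d
  · exact a ▸ petersen_adj_outer h2 _
  · exact b ▸ (petersen_adj_outer h2 _).symm
  · rw [c, e]; exact petersen_adj_outer h2 _
  · rw [d, e]; exact (petersen_adj_outer h2 _).symm
  · exact petersen_adj_spoke j
  · exact a ▸ petersen_adj_inner h1 _
  · exact b ▸ (petersen_adj_inner h1 _).symm
  · rw [c, e']; exact petersen_adj_inner h1 _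
  · rw [d, e']; exact (petersen_adj_inner h1 _).symm
  · exact (petersen_adj_spoke j).symm

/-- Every forcing set of the matching of all spokes meets any four consecutive spokes. -/
lemma IsForcingSet.exists_spoke_mem {n : ℕ} (hn : 4 ≤ n) {M : (petersen n).Subgraph}
    (hE : M.edgeSet = {e | ∃ i : ZMod n, e = s(pu i, pv i)}) {S : Set (Sym2 (PV n))}
    (hS : IsForcingSet (petersen n) M S) (i : ZMod n) :
    ∃ d ∈ Finset.range 4, s(pu (i + (d : ZMod n)), pv (i + (d : ZMod n))) ∈ S := by
  by_contra! hcon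
  have h1 : (1 : ZMod n) ≠ 0 := by
    exact_mod_cast natCast_zmod_ne_zero (n := n) (k := 1) (by omega) (by omega)
  have h2 : (2 : ZMod n) ≠ 0 := by
    exact_mod_cast natCast_zmod_ne_zero (n := n) (k := 2) (by omega) (by omega)
  have h3 : (3 : ZMod n) ≠ 0 := by
    exact_mod_cast natCast_zmod_ne_zero (n := n) (k := 3) (by omega) (by omega)
  have hinv := blockAPartner_blockAPartner h1 h2 h3 i
  let M' : (petersen n).Subgraph :=
    { verts := Set.univ
      Adj := fun x y => blockAPartner i x = y
      adj_sub := fun {x _} h => h ▸ petersen_adj_blockAPartner h1 h2 i x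
      edge_vert := fun _ => Set.mem_univ _
      symm := ⟨fun x _ h => h ▸ hinv x⟩ }
  have hM' : M'.IsPerfectMatching :=
    SimpleGraph.Subgraph.isPerfectMatching_iff.2 fun x =>
      ⟨blockAPartner i x, rfl, fun _ h => Eq.symm h⟩
  have hsub : S ⊆ M'.edgeSet := by
    intro e he
    obtain ⟨j, rfl⟩ : e ∈ {e | ∃ i : ZMod n, e = s(pu i, pv i)} := hE ▸ hS.1 he
    have hne (d : ℕ) (hd : d < 4) : j ≠ i + (d : ZMod n) := by
      rintro rfl
      exact hcon d (Finset.mem_range.2 hd) he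
    have e0 : j ≠ i := by simpa using hne 0 (by omega)
    have e1 : j ≠ i + 1 := by simpa using hne 1 (by omega)
    have e2 : j ≠ i + 2 := by simpa using hne 2 (by omega)
    have e3 : j ≠ i + 3 := by simpa using hne 3 (by omega)
    change blockAPartner i (pu j) = pv j
    simp [blockAPartner, pu, e0, e1, e2, e3]
  have hmem : s(pu i, pv i) ∈ M'.edgeSet := by
    rw [hS.2 M' hM' hsub, hE]
    exact ⟨i, rfl⟩
  have hbad : blockAPartner i (pu i) = pv i := hmem
  simp [blockAPartner, pu, pv] at hbad

lemma IsForcingSet.le_four_mul_ncard {n : ℕ} (hn : 4 ≤ n) {M : (petersen n).Subgraph}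
    (hE : M.edgeSet = {e | ∃ i : ZMod n, e = s(pu i, pv i)}) {S : Set (Sym2 (PV n))}
    (hS : IsForcingSet (petersen n) M S) : n ≤ 4 * S.ncard := by
  classical
  have : NeZero n := ⟨by omega⟩
  let T : Finset (ZMod n) := {j | s(pu j, pv j) ∈ S}
  have hcover : (Finset.univ : Finset (ZMod n)) ⊆
      (Finset.range 4).biUnion fun d => T.image fun j => j - (d : ZMod n) := by
    intro i _
    obtain ⟨d, hd, h⟩ := hS.exists_spoke_mem hn hE i
    simp only [Finset.mem_biUnion, Finset.mem_image]
    exact ⟨d, hd, i + d, by simpa [T] using h, by simp⟩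
  have hcard := (Finset.card_le_card hcover).trans
    (Finset.card_biUnion_le_card_mul _ _ T.card fun d _ => Finset.card_image_le)
  rw [Finset.card_univ, ZMod.card, Finset.card_range] at hcard
  have hTS : T.card ≤ S.ncard := by
    rw [← Set.ncard_coe_finset, ← Set.ncard_image_of_injective _ (spoke_injective n)]
    refine Set.ncard_le_ncard ?_ (Set.toFinite S)
    rintro _ ⟨j, hj, rfl⟩
    simpa [T] using hj
  omega

/-- for `n ≥ 9`, the perfect matching of `P(n,2)` consisting of all `n` spokes
has forcing number `⌈n/4⌉ = (n+3)/4`, and `S = {u_{4i} v_{4i} : 0 ≤ i ≤ ⌈n/4⌉ - 1}` is a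
minimum forcing set of it. -/
theorem all_spokes_forcing (n : ℕ) (hn : 9 ≤ n) (M : (petersen n).Subgraph)
    (hE : M.edgeSet = {e | ∃ i : ZMod n, e = s(pu i, pv i)}) :
    M.IsPerfectMatching ∧
    forcingNumber (petersen n) M = (n + 3) / 4 ∧
    IsForcingSet (petersen n) M
      {e | ∃ i : ℕ, i < (n + 3) / 4 ∧
        e = s(pu ((4 * i : ℕ) : ZMod n), pv ((4 * i : ℕ) : ZMod n))} ∧
    {e : Sym2 (PV n) | ∃ i : ℕ, i < (n + 3) / 4 ∧
        e = s(pu ((4 * i : ℕ) : ZMod n), pv ((4 * i : ℕ) : ZMod n))}.ncard = (n + 3) / 4 := by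
  have hM := isPerfectMatching_of_edgeSet_eq_spokes hE
  have hlt (i : ℕ) : i < (n + 3) / 4 ↔ 4 * i < n := by omega
  have hforce : IsForcingSet (petersen n) M
      {e | ∃ i : ℕ, i < (n + 3) / 4 ∧
        e = s(pu ((4 * i : ℕ) : ZMod n), pv ((4 * i : ℕ) : ZMod n))} := by
    refine ⟨?_, fun M' hM' hsub => hM.eq_of_edgeSet_subset hM' ?_⟩
    · rintro _ ⟨i, -, rfl⟩
      exact hE ▸ ⟨_, rfl⟩
    · rw [hE]
      rintro _ ⟨i, rfl⟩
      exact spoke_of_multiples_of_four (by omega) hM'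
        (fun k hk => hsub ⟨k, (hlt k).2 hk, rfl⟩) i
  have hcard : {e : Sym2 (PV n) | ∃ i : ℕ, i < (n + 3) / 4 ∧
      e = s(pu ((4 * i : ℕ) : ZMod n), pv ((4 * i : ℕ) : ZMod n))}.ncard = (n + 3) / 4 := by
    have himage : {e : Sym2 (PV n) | ∃ i : ℕ, i < (n + 3) / 4 ∧
        e = s(pu ((4 * i : ℕ) : ZMod n), pv ((4 * i : ℕ) : ZMod n))} =
        (fun i : ℕ => s(pu ((4 * i : ℕ) : ZMod n), pv ((4 * i : ℕ) : ZMod n))) ''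
          (Finset.range ((n + 3) / 4) : Set ℕ) := by
      ext e
      simp [eq_comm]
    rw [himage, Set.InjOn.ncard_image, Set.ncard_coe_finset, Finset.card_range]
    intro i hi j hj hij
    rw [Finset.mem_coe, Finset.mem_range, hlt] at hi hj
    have h := (ZMod.natCast_eq_natCast_iff' _ _ _).1 (spoke_injective n hij)
    rw [Nat.mod_eq_of_lt hi, Nat.mod_eq_of_lt hj] at h
    omega
  refine ⟨hM, le_antisymm (Nat.sInf_le ⟨_, hforce, hcard⟩) ?_, hforce, hcard⟩
  refine le_csInf ⟨_, _, hforce, hcard⟩ ?_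
  rintro _ ⟨S, hS, rfl⟩
  have := hS.le_four_mul_ncard (by omega) hE
  omega
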